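/- arXiv:1402.4520 — 2 statements merged into one kernel-verified Lean document; each statement's English description precedes it below -/
import Mathlib

section
/- Let n ≥ m ≥ 1, let Σ be an m×m real positive definite matrix, Θ an n×n real positive definite matrix, μ an n×m real matrix, ρ > 0, k ∈ ℝ and ν > 0 with ν/2 − k > 0, and τ = (t₁, …, t_m) ∈ ℝ^m with n/2 − t_i − (m−i)/2 > 0 for all i. Let S and Y be independent random variables on a probability space, where S > 0 has density s^{ν/2−k−1} e^{−s/ρ}/(Γ(ν/2−k) ρ^{ν/2−k}) on (0, ∞), and Y has the Kotz-Riesz type II distribution KR^{II}_{n×m}(τ, 0, Θ, Σ). Then T = S^{−1/2} Y + μ has, with respect to Lebesgue measure on n×m real matrices, the density c · [1 + ρ·tr(Σ^{−1}(T−μ)ᵀ Θ^{−1}(T−μ))]^{−[(ν+mn)/2 − k − Σᵢtᵢ]} · q_τ([u(Σ)^{−ᵀ}(T−μ)ᵀ Θ^{−1}(T−μ) u(Σ)^{−1}]^{−1}), where c = Γ_m(n/2) · Γ((ν+mn)/2 − k − Σᵢtᵢ) · ρ^{mn/2 − Σᵢtᵢ} / (π^{mn/2} Γ_m(n/2, −τ)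 Γ(ν/2−k) (det Σ)^{n/2} (det Θ)^{m/2}). This is the matrix multivariate T-Riesz type II density. -/
open MeasureTheory Matrix Real

/-- Lebesgue (product) measure on `n × m` real matrices, via the identification with `ℝ^{nm}`. -/
noncomputable instance matMeasureSpace (n m : ℕ) : MeasureSpace (Matrix (Fin n) (Fin m) ℝ) :=
  (inferInstance : MeasureSpace (Fin n → Fin m → ℝ))

/-- Determinant of the leading principal `(i+1) × (i+1)` submatrix. -/
noncomputable def princMinor {m : ℕ} (A : Matrix (Fin m) (Fin m) ℝ) (i : Fin m) : ℝ :=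
  (A.submatrix (fun j : Fin (i.1 + 1) => Fin.castLE i.isLt j)
    (fun j : Fin (i.1 + 1) => Fin.castLE i.isLt j)).det

/-- The highest weight vector (generalized power)
`q_κ(A) = det(A)^{k_m} ∏_{i=1}^{m-1} det(A_i)^{k_i - k_{i+1}}`. -/
noncomputable def hwv {m : ℕ} (κ : Fin m → ℝ) (A : Matrix (Fin m) (Fin m) ℝ) : ℝ :=
  ∏ i : Fin m, princMinor A i ^ (if h : i.1 + 1 < m then κ i - κ ⟨i.1 + 1, h⟩ else κ i)

/-- The real multivariate gamma function `Γ_m(a) = π^{m(m-1)/4} ∏ Γ(a - (i-1)/2)`. -/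
noncomputable def mvGamma (m : ℕ) (a : ℝ) : ℝ :=
  Real.pi ^ (((m * (m - 1) : ℕ) : ℝ) / 4) * ∏ i : Fin m, Real.Gamma (a - (i : ℝ) / 2)

/-- The generalized gamma function of weight `τ`:
`Γ_m(a, τ) = π^{m(m-1)/4} ∏ Γ(a + t_i - (i-1)/2)`. -/
noncomputable def mvGammaI (m : ℕ) (a : ℝ) (τ : Fin m → ℝ) : ℝ :=
  Real.pi ^ (((m * (m - 1) : ℕ) : ℝ) / 4) * ∏ i : Fin m, Real.Gamma (a + τ i - (i : ℝ) / 2)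

/-- The generalized gamma function of weight `-τ`:
`Γ_m(a, -τ) = π^{m(m-1)/4} ∏ Γ(a - t_i - (m-i)/2)`. -/
noncomputable def mvGammaII (m : ℕ) (a : ℝ) (τ : Fin m → ℝ) : ℝ :=
  Real.pi ^ (((m * (m - 1) : ℕ) : ℝ) / 4) *
    ∏ i : Fin m, Real.Gamma (a - τ i - ((m : ℝ) - 1 - (i : ℝ)) / 2)

/-- Lebesgue measure on `m × m` real symmetric matrices: the pushforward of the product
Lebesgue measure in the coordinates `(x_{ij})_{i ≤ j}` under the obvious parametrization. -/
noncomputable def symmVol (m : ℕ) : Measure (Matrix (Fin m) (Fin m) ℝ) :=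
  Measure.map (fun f : {p : Fin m × Fin m // p.1 ≤ p.2} → ℝ =>
    Matrix.of fun i j => if h : i ≤ j then f ⟨(i, j), h⟩ else f ⟨(j, i), le_of_not_ge h⟩) volume

/-- The eigenvalues of `XᵀX`, arranged in decreasing order. -/
noncomputable def sortedEigs {n m : ℕ} (X : Matrix (Fin n) (Fin m) ℝ) : Fin m → ℝ :=
  fun i =>
    ((Matrix.isHermitian_conjTranspose_mul_self X).eigenvalues ∘
      Tuple.sort (Matrix.isHermitian_conjTranspose_mul_self X).eigenvalues) (Fin.rev i)

/-- The singular values of an `n × m` real matrix, in decreasing order. -/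
noncomputable def svalues {n m : ℕ} (X : Matrix (Fin n) (Fin m) ℝ) : Fin m → ℝ :=
  fun i => Real.sqrt (sortedEigs X i)

/-- The Kotz-Riesz type I density `KR^I_{n×m}(τ, μ, Θ, Σ)` (with `U = u(Σ)` the upper
triangular Cholesky factor of `Σ`, supplied explicitly). -/
noncomputable def kotzRieszIDen (n m : ℕ) (τ : Fin m → ℝ) (μ : Matrix (Fin n) (Fin m) ℝ)
    (Θ : Matrix (Fin n) (Fin n) ℝ) (Sig U : Matrix (Fin m) (Fin m) ℝ)
    (y : Matrix (Fin n) (Fin m) ℝ) : ℝ :=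
  mvGamma m ((n : ℝ) / 2) /
      (Real.pi ^ (((m * n : ℕ) : ℝ) / 2) * mvGammaI m ((n : ℝ) / 2) τ *
        Sig.det ^ ((n : ℝ) / 2) * Θ.det ^ ((m : ℝ) / 2)) *
    Real.exp (-(Sig⁻¹ * (y - μ)ᵀ * Θ⁻¹ * (y - μ)).trace) *
    hwv τ ((Uᵀ)⁻¹ * (y - μ)ᵀ * Θ⁻¹ * (y - μ) * U⁻¹)

/-- The Kotz-Riesz type II density `KR^{II}_{n×m}(τ, μ, Θ, Σ)` (with `U = u(Σ)` the upper
triangular Cholesky factor of `Σ`, supplied explicitly). -/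
noncomputable def kotzRieszIIDen (n m : ℕ) (τ : Fin m → ℝ) (μ : Matrix (Fin n) (Fin m) ℝ)
    (Θ : Matrix (Fin n) (Fin n) ℝ) (Sig U : Matrix (Fin m) (Fin m) ℝ)
    (y : Matrix (Fin n) (Fin m) ℝ) : ℝ :=
  mvGamma m ((n : ℝ) / 2) /
      (Real.pi ^ (((m * n : ℕ) : ℝ) / 2) * mvGammaII m ((n : ℝ) / 2) τ *
        Sig.det ^ ((n : ℝ) / 2) * Θ.det ^ ((m : ℝ) / 2)) *
    Real.exp (-(Sig⁻¹ * (y - μ)ᵀ * Θ⁻¹ * (y - μ)).trace) *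
    hwv τ (((Uᵀ)⁻¹ * (y - μ)ᵀ * Θ⁻¹ * (y - μ) * U⁻¹)⁻¹)

/-- The matrix multivariate T-Riesz type I density
`MTR^I(ν, k, τ, ρ, μ, Θ, Σ)` (with `U = u(Σ)` supplied explicitly). -/
noncomputable def tRieszIDen (n m : ℕ) (ν k ρ : ℝ) (τ : Fin m → ℝ)
    (μ : Matrix (Fin n) (Fin m) ℝ) (Θ : Matrix (Fin n) (Fin n) ℝ)
    (Sig U : Matrix (Fin m) (Fin m) ℝ) (t : Matrix (Fin n) (Fin m) ℝ) : ℝ :=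
  mvGamma m ((n : ℝ) / 2) * Real.Gamma ((ν + (m * n : ℕ)) / 2 + k + ∑ i, τ i) *
      ρ ^ (((m * n : ℕ) : ℝ) / 2 + ∑ i, τ i) /
      (Real.pi ^ (((m * n : ℕ) : ℝ) / 2) * mvGammaI m ((n : ℝ) / 2) τ *
        Real.Gamma (ν / 2 + k) * Sig.det ^ ((n : ℝ) / 2) * Θ.det ^ ((m : ℝ) / 2)) *
    (1 + ρ * (Sig⁻¹ * (t - μ)ᵀ * Θ⁻¹ * (t - μ)).trace) ^
      (-((ν + (m * n : ℕ)) / 2 + k + ∑ i, τ i)) *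
    hwv τ ((Uᵀ)⁻¹ * (t - μ)ᵀ * Θ⁻¹ * (t - μ) * U⁻¹)

/-- The matrix multivariate T-Riesz type II density
`MTR^{II}(ν, k, τ, ρ, μ, Θ, Σ)` (with `U = u(Σ)` supplied explicitly). -/
noncomputable def tRieszIIDen (n m : ℕ) (ν k ρ : ℝ) (τ : Fin m → ℝ)
    (μ : Matrix (Fin n) (Fin m) ℝ) (Θ : Matrix (Fin n) (Fin n) ℝ)
    (Sig U : Matrix (Fin m) (Fin m) ℝ) (t : Matrix (Fin n) (Fin m) ℝ) : ℝ :=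
  mvGamma m ((n : ℝ) / 2) * Real.Gamma ((ν + (m * n : ℕ)) / 2 - k - ∑ i, τ i) *
      ρ ^ (((m * n : ℕ) : ℝ) / 2 - ∑ i, τ i) /
      (Real.pi ^ (((m * n : ℕ) : ℝ) / 2) * mvGammaII m ((n : ℝ) / 2) τ *
        Real.Gamma (ν / 2 - k) * Sig.det ^ ((n : ℝ) / 2) * Θ.det ^ ((m : ℝ) / 2)) *
    (1 + ρ * (Sig⁻¹ * (t - μ)ᵀ * Θ⁻¹ * (t - μ)).trace) ^
      (-((ν + (m * n : ℕ)) / 2 - k - ∑ i, τ i)) *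
    hwv τ (((Uᵀ)⁻¹ * (t - μ)ᵀ * Θ⁻¹ * (t - μ) * U⁻¹)⁻¹)

theorem lintegral_smul_sub {E : Type*} [NormedAddCommGroup E] [NormedSpace ℝ E]
    [FiniteDimensional ℝ E] [MeasurableSpace E] [BorelSpace E] (ν : Measure E)
    [ν.IsAddHaarMeasure] (F : E → ENNReal) (hF : Measurable F) (c : E) {r : ℝ} (hr : 0 < r) :
    ∫⁻ y, F y ∂ν =
      ENNReal.ofReal (r ^ Module.finrank ℝ E) * ∫⁻ t, F (r • (t - c)) ∂ν := by
  rw [lintegral_sub_right_eq_self (fun t => F (r • t)) c,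
    ← lintegral_map hF (measurable_const_smul r), Measure.map_addHaar_smul ν hr.ne',
    lintegral_smul_measure, smul_eq_mul, ← mul_assoc, ← ENNReal.ofReal_mul (by positivity),
    abs_of_pos (by positivity), mul_inv_cancel₀ (by positivity), ENNReal.ofReal_one, one_mul]

theorem map_rpow_smul_add_prod_withDensity {E : Type*} [NormedAddCommGroup E] [NormedSpace ℝ E]
    [FiniteDimensional ℝ E] [MeasurableSpace E] [BorelSpace E] (ν : Measure E)
    [ν.IsAddHaarMeasure] (g : ℝ → ENNReal) (hg : Measurable g) (hg0 : ∀ s ≤ 0, g s = 0)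
    (f : E → ENNReal) (hf : Measurable f) (c : E) :
    Measure.map (fun p : ℝ × E => p.1 ^ (-(1 : ℝ) / 2) • p.2 + c)
        ((volume.withDensity g).prod (ν.withDensity f)) =
      ν.withDensity fun t => ∫⁻ s in Set.Ioi (0 : ℝ),
        g s * ENNReal.ofReal (s ^ ((1 : ℝ) / 2 * Module.finrank ℝ E)) *
          f (s ^ ((1 : ℝ) / 2) • (t - c)) := by
  have hΦ : Measurable (fun p : ℝ × E => p.1 ^ (-(1 : ℝ) / 2) • p.2 + c) := by fun_prop
  have hK : Measurable (fun p : ℝ × E => g p.1 *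
      ENNReal.ofReal (p.1 ^ ((1 : ℝ) / 2 * Module.finrank ℝ E)) *
          f (p.1 ^ ((1 : ℝ) / 2) • (p.2 - c))) := by fun_prop
  classical
  ext A hA
  rw [prod_withDensity hg hf, Measure.map_apply hΦ hA, withDensity_apply _ (hΦ hA),
    withDensity_apply _ hA, ← lintegral_indicator (hΦ hA),
    lintegral_prod _ (Measurable.aemeasurable (by measurability)),
    lintegral_lintegral_swap
      (f := fun t s => g s * ENNReal.ofReal (s ^ ((1 : ℝ) / 2 * Module.finrank ℝ E)) *
          f (s ^ ((1 : ℝ) / 2) • (t - c))) (hK.comp measurable_swap).aemeasurable,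
    ← lintegral_indicator measurableSet_Ioi]
  refine lintegral_congr fun s => ?_
  by_cases hs : 0 < s
  · have hr : 0 < s ^ ((1 : ℝ) / 2) := by positivity
    rw [lintegral_smul_sub ν _ (by
      exact (Measurable.indicator (by fun_prop) (hΦ hA)).comp measurable_prodMk_left) c hr,
      Set.indicator_of_mem (Set.mem_Ioi.2 hs), ← lintegral_const_mul' _ _ ENNReal.ofReal_ne_top,
      ← lintegral_indicator hA]
    refine lintegral_congr fun t => ?_
    have h1 : s ^ (-(1 : ℝ) / 2) • s ^ ((1 : ℝ) / 2) • (t - c) + c = t := by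
      rw [smul_smul, ← Real.rpow_add hs]; norm_num
    simp only [Set.indicator_apply, Set.mem_preimage, h1]
    rw [← Real.rpow_natCast, ← Real.rpow_mul hs.le]
    split_ifs
    · ring
    · simp
  · simp [hs, Set.indicator_apply, hg0 s (not_lt.1 hs)]

theorem lintegral_rpow_mul_exp_neg_mul_Ioi {a r : ℝ} (ha : 0 < a) (hr : 0 < r) :
    ∫⁻ s in Set.Ioi (0 : ℝ), ENNReal.ofReal (s ^ (a - 1) * Real.exp (-(r * s))) =
      ENNReal.ofReal ((1 / r) ^ a * Real.Gamma a) := by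
  have h := Real.integral_rpow_mul_exp_neg_mul_Ioi ha hr
  rw [← h, ofReal_integral_eq_lintegral_ofReal]
  · by_contra hi
    rw [integral_undef hi] at h
    have := Real.Gamma_pos_of_pos ha
    have : 0 < (1 / r) ^ a * Real.Gamma a := by positivity
    linarith
  · filter_upwards [ae_restrict_mem measurableSet_Ioi] with s hs
    have : 0 < s := hs
    positivity

theorem mul_rpow_of_pos_left {c : ℝ} (hc : 0 < c) (x p : ℝ) : (c * x) ^ p = c ^ p * x ^ p := by
  rcases lt_trichotomy x 0 with hx | rfl | hx
  · rw [Real.rpow_def_of_neg (by nlinarith), Real.rpow_def_of_neg hx,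
      Real.log_mul hc.ne' hx.ne, Real.rpow_def_of_pos hc, add_mul, Real.exp_add, mul_assoc]
  · rcases eq_or_ne p 0 with rfl | hp
    · simp
    · simp [Real.zero_rpow hp]
  · exact Real.mul_rpow hc.le hx.le

theorem sum_succ_mul_sub_succ {m : ℕ} (κ : Fin m → ℝ) :
    ∑ i : Fin m, ((i : ℝ) + 1) *
      (if h : i.1 + 1 < m then κ i - κ ⟨i.1 + 1, h⟩ else κ i) = ∑ i, κ i := by
  set F : ℕ → ℝ := fun i => if h : i < m then κ ⟨i, h⟩ else 0 with hF
  have h1 : ∀ i : Fin m, (if h : i.1 + 1 < m then κ i - κ ⟨i.1 + 1, h⟩ else κ i) =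
      F i - F (i + 1) := by
    intro i
    simp only [hF, i.isLt, dif_pos]
    split_ifs <;> simp
  have h2 : ∀ i : Fin m, κ i = F i := by intro i; simp [hF]
  simp_rw [h1]
  rw [Finset.sum_congr rfl fun i _ => h2 i,
    Fin.sum_univ_eq_sum_range (fun i : ℕ => ((i : ℝ) + 1) * (F i - F (i + 1))),
    Fin.sum_univ_eq_sum_range F]
  have h3 : ∀ N : ℕ, ∑ i ∈ Finset.range N, ((i : ℝ) + 1) * (F i - F (i + 1)) =
      ∑ i ∈ Finset.range N, F i - N * F N := by
    intro N
    induction N with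
    | zero => simp
    | succ N ih => rw [Finset.sum_range_succ, ih, Finset.sum_range_succ]; push_cast; ring
  rw [h3, show F m = 0 by simp [hF]]
  ring

theorem hwv_smul {m : ℕ} (κ : Fin m → ℝ) {c : ℝ} (hc : 0 < c) (A : Matrix (Fin m) (Fin m) ℝ) :
    hwv κ (c • A) = c ^ (∑ i, κ i) * hwv κ A := by
  have h : ∀ i, princMinor (c • A) i = c ^ ((i : ℝ) + 1) * princMinor A i := by
    intro i
    rw [princMinor, princMinor, Matrix.submatrix_smul, Pi.smul_apply, Pi.smul_apply,
      Matrix.det_smul, Fintype.card_fin, ← Real.rpow_natCast]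
    push_cast
    rfl
  simp_rw [hwv, h, mul_rpow_of_pos_left (Real.rpow_pos_of_pos hc _), ← Real.rpow_mul hc.le]
  rw [Finset.prod_mul_distrib, ← Real.rpow_sum_of_pos hc, sum_succ_mul_sub_succ]

theorem nonsing_inv_smul_of_ne_zero {m : ℕ} {c : ℝ} (hc : c ≠ 0)
    (A : Matrix (Fin m) (Fin m) ℝ) : (c • A)⁻¹ = c⁻¹ • A⁻¹ := by
  by_cases h : IsUnit A.det
  · exact Matrix.inv_smul' A (Units.mk0 c hc) h
  · rw [Matrix.nonsing_inv_apply_not_isUnit _ h, Matrix.nonsing_inv_apply_not_isUnit, smul_zero]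
    simpa [Matrix.det_smul, hc] using h

theorem measurable_hwv_inv {n m : ℕ} (τ : Fin m → ℝ)
    (W : (Fin n → Fin m → ℝ) → Matrix (Fin m) (Fin m) ℝ) (hW : Continuous W) :
    Measurable fun y => hwv τ (W y)⁻¹ := by
  have hW' : ∀ i j, Continuous fun y => W y i j := fun i j => hW.matrix_elem i j
  refine Finset.measurable_prod _ fun i _ => Measurable.pow_const ?_ _
  simp only [princMinor, Matrix.det_apply']
  refine Finset.measurable_sum _ fun σ _ => measurable_const.mul ?_
  refine Finset.measurable_prod _ fun j _ => ?_
  simp only [Matrix.submatrix_apply, Matrix.inv_def, Matrix.smul_apply, smul_eq_mul,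
    Ring.inverse_eq_inv']
  exact hW.matrix_det.measurable.inv.mul (hW.matrix_adjugate.matrix_elem _ _).measurable

theorem measurable_kotzRieszIIDen (n m : ℕ) (τ : Fin m → ℝ)
    (Θ : Matrix (Fin n) (Fin n) ℝ) (Sig U : Matrix (Fin m) (Fin m) ℝ) :
    Measurable (fun y : Fin n → Fin m → ℝ => kotzRieszIIDen n m τ 0 Θ Sig U y) := by
  have hy : Continuous fun y : Matrix (Fin n) (Fin m) ℝ => y - 0 := by fun_prop
  have hc : ∀ A : Matrix (Fin m) (Fin m) ℝ, Continuous
      fun y : Matrix (Fin n) (Fin m) ℝ => A * (y - 0)ᵀ * Θ⁻¹ * (y - 0) :=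
    fun A => (((continuous_const.matrix_mul hy.matrix_transpose).matrix_mul
      continuous_const).matrix_mul hy)
  refine Measurable.mul (measurable_const.mul ?_) ?_
  · exact Real.measurable_exp.comp
      (Continuous.measurable (α := Fin n → Fin m → ℝ) (hc _).matrix_trace.neg)
  · exact measurable_hwv_inv τ _ ((hc _).matrix_mul continuous_const)

theorem trace_inv_mul_transpose_mul_inv_mul_nonneg {n m : ℕ}
    {Sig : Matrix (Fin m) (Fin m) ℝ} {Θ : Matrix (Fin n) (Fin n) ℝ} (hΘ : Θ.PosDef)
    (U : Matrix (Fin m) (Fin m) ℝ) (hUSig : Sig = Uᵀ * U) (Z : Matrix (Fin n) (Fin m) ℝ) :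
    0 ≤ (Sig⁻¹ * Zᵀ * Θ⁻¹ * Z).trace := by
  have h := (hΘ.inv.posSemidef.conjTranspose_mul_mul_same (Z * U⁻¹)).trace_nonneg
  refine h.trans_eq ?_
  symm
  rw [hUSig, Matrix.mul_inv_rev, Matrix.mul_assoc, Matrix.mul_assoc, Matrix.mul_assoc,
    Matrix.trace_mul_comm, Matrix.conjTranspose_eq_transpose_of_trivial, Matrix.transpose_mul,
    Matrix.transpose_nonsing_inv]
  simp only [Matrix.mul_assoc]

theorem sum_lt_of_pos_gamma_args {n m : ℕ} (hm : 1 ≤ m) (τ : Fin m → ℝ)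
    (hτ : ∀ i : Fin m, 0 < (n : ℝ) / 2 - τ i - ((m : ℝ) - 1 - (i : ℝ)) / 2) :
    ∑ i, τ i < ((m * n : ℕ) : ℝ) / 2 := by
  have : Nonempty (Fin m) := ⟨⟨0, hm⟩⟩
  have h : ∑ i, τ i < ∑ _i : Fin m, (n : ℝ) / 2 :=
    Finset.sum_lt_sum_of_nonempty Finset.univ_nonempty fun i _ => by
      have h1 := hτ i
      have h2 : ((i : ℕ) : ℝ) + 1 ≤ m := by exact_mod_cast i.isLt
      linarith
  simp only [Finset.sum_const, Finset.card_univ, Fintype.card_fin, nsmul_eq_mul] at h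
  push_cast
  linarith

theorem kotzRieszIIDen_rpow_half_smul (n m : ℕ) (τ : Fin m → ℝ) (Θ : Matrix (Fin n) (Fin n) ℝ)
    (Sig U : Matrix (Fin m) (Fin m) ℝ) (Z : Matrix (Fin n) (Fin m) ℝ) {s : ℝ} (hs : 0 < s) :
    kotzRieszIIDen n m τ 0 Θ Sig U (s ^ ((1 : ℝ) / 2) • Z) =
      mvGamma m ((n : ℝ) / 2) /
        (Real.pi ^ (((m * n : ℕ) : ℝ) / 2) * mvGammaII m ((n : ℝ) / 2) τ *
          Sig.det ^ ((n : ℝ) / 2) * Θ.det ^ ((m : ℝ) / 2)) *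
      Real.exp (-(s * (Sig⁻¹ * Zᵀ * Θ⁻¹ * Z).trace)) *
      (s ^ (-∑ i, τ i) * hwv τ (((Uᵀ)⁻¹ * Zᵀ * Θ⁻¹ * Z * U⁻¹)⁻¹)) := by
  have hr : s ^ ((1 : ℝ) / 2) * s ^ ((1 : ℝ) / 2) = s := by
    rw [← Real.rpow_add hs]; norm_num
  have h : ∀ A : Matrix (Fin m) (Fin m) ℝ,
      A * (s ^ ((1 : ℝ) / 2) • Z - 0)ᵀ * Θ⁻¹ * (s ^ ((1 : ℝ) / 2) • Z - 0) =
        s • (A * Zᵀ * Θ⁻¹ * Z) := by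
    intro A
    rw [sub_zero, Matrix.transpose_smul]
    simp only [Matrix.mul_smul, Matrix.smul_mul, smul_smul, hr]
  rw [kotzRieszIIDen, h, h, Matrix.trace_smul, smul_eq_mul, Matrix.smul_mul,
    nonsing_inv_smul_of_ne_zero hs.ne', hwv_smul τ (inv_pos.2 hs), Real.inv_rpow hs.le,
    ← Real.rpow_neg hs.le]

theorem lintegral_gamma_mul_kotzRieszIIDen {n m : ℕ} (hm : 1 ≤ m)
    (Sig : Matrix (Fin m) (Fin m) ℝ)
    (Θ : Matrix (Fin n) (Fin n) ℝ) (hΘ : Θ.PosDef)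
    (μ : Matrix (Fin n) (Fin m) ℝ) {ρ k ν : ℝ} (hρ : 0 < ρ)
    (hνk : 0 < ν / 2 - k) (τ : Fin m → ℝ)
    (hτ : ∀ i : Fin m, 0 < (n : ℝ) / 2 - τ i - ((m : ℝ) - 1 - (i : ℝ)) / 2)
    (U : Matrix (Fin m) (Fin m) ℝ) (hUSig : Sig = Uᵀ * U) (t : Matrix (Fin n) (Fin m) ℝ) :
    ∫⁻ s in Set.Ioi (0 : ℝ), (if 0 < s then
        ENNReal.ofReal (s ^ (ν / 2 - k - 1) * Real.exp (-s / ρ) /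
          (Real.Gamma (ν / 2 - k) * ρ ^ (ν / 2 - k))) else 0) *
        ENNReal.ofReal (s ^ ((1 : ℝ) / 2 * Module.finrank ℝ (Fin n → Fin m → ℝ))) *
        ENNReal.ofReal (kotzRieszIIDen n m τ 0 Θ Sig U (s ^ ((1 : ℝ) / 2) • (t - μ))) =
      ENNReal.ofReal (tRieszIIDen n m ν k ρ τ μ Θ Sig U t) := by
  have hd : (Module.finrank ℝ (Fin n → Fin m → ℝ) : ℝ) = ((m * n : ℕ) : ℝ) := by
    simp [Module.finrank_pi_fintype, mul_comm]
  have hsum := sum_lt_of_pos_gamma_args hm τ hτ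
  have htr := trace_inv_mul_transpose_mul_inv_mul_nonneg hΘ U hUSig (t - μ)
  rw [hd]
  generalize hB : Real.Gamma (ν / 2 - k) = B
  have hBpos : 0 < B := hB ▸ Real.Gamma_pos_of_pos hνk
  simp only [tRieszIIDen]
  rw [hB]
  set q := (Sig⁻¹ * (t - μ)ᵀ * Θ⁻¹ * (t - μ)).trace
  set H := hwv τ (((Uᵀ)⁻¹ * (t - μ)ᵀ * Θ⁻¹ * (t - μ) * U⁻¹)⁻¹) with hH
  set N : ℝ := ((m * n : ℕ) : ℝ)
  set a := (ν + N) / 2 - k - ∑ i, τ i with ha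
  have hapos : 0 < a := by rw [ha]; linarith
  set G := mvGamma m ((n : ℝ) / 2)
  set D := Real.pi ^ (N / 2)
  set M := mvGammaII m ((n : ℝ) / 2) τ
  set c := G / (D * M * Sig.det ^ ((n : ℝ) / 2) * Θ.det ^ ((m : ℝ) / 2)) with hc
  have hr : 0 < 1 / ρ + q := by positivity
  have key : ∀ s ∈ Set.Ioi (0 : ℝ), (if 0 < s then
        ENNReal.ofReal (s ^ (ν / 2 - k - 1) * Real.exp (-s / ρ) / (B * ρ ^ (ν / 2 - k))) else 0) *
        ENNReal.ofReal (s ^ ((1 : ℝ) / 2 * N)) *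
        ENNReal.ofReal (kotzRieszIIDen n m τ 0 Θ Sig U (s ^ ((1 : ℝ) / 2) • (t - μ))) =
      ENNReal.ofReal (s ^ (a - 1) * Real.exp (-((1 / ρ + q) * s))) *
        ENNReal.ofReal (c * H / (B * ρ ^ (ν / 2 - k))) := by
    intro s hs
    have hs : 0 < s := hs
    rw [if_pos hs, kotzRieszIIDen_rpow_half_smul n m τ Θ Sig U _ hs,
      ← ENNReal.ofReal_mul (by positivity), ← ENNReal.ofReal_mul (by positivity),
      ← ENNReal.ofReal_mul (by positivity)]
    have h1 : s ^ (a - 1) = s ^ (ν / 2 - k - 1) * s ^ ((1 : ℝ) / 2 * N) * s ^ (-∑ i, τ i) := by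
      rw [← Real.rpow_add hs, ← Real.rpow_add hs, ha]
      ring_nf
    have h2 : Real.exp (-((1 / ρ + q) * s)) = Real.exp (-s / ρ) * Real.exp (-(s * q)) := by
      rw [← Real.exp_add]; ring_nf
    rw [h1, h2, ← hc, ← hH]
    congr 1
    ring
  rw [setLIntegral_congr_fun measurableSet_Ioi key,
    lintegral_mul_const' _ _ ENNReal.ofReal_ne_top,
    lintegral_rpow_mul_exp_neg_mul_Ioi hapos hr, ← ENNReal.ofReal_mul (by
      have := Real.Gamma_pos_of_pos hapos
      positivity)]
  congr 1
  have h3 : (1 / (1 / ρ + q)) ^ a = ρ ^ a * (1 + ρ * q) ^ (-a) := by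
    rw [Real.rpow_neg (by positivity), ← Real.inv_rpow (by positivity),
      ← Real.mul_rpow hρ.le (by positivity)]
    congr 1
    field_simp
  have h4 : ρ ^ a = ρ ^ (N / 2 - ∑ i, τ i) * ρ ^ (ν / 2 - k) := by
    rw [← Real.rpow_add hρ, ha]
    ring_nf
  rw [h3, h4, hc]
  have := Real.rpow_pos_of_pos hρ (ν / 2 - k)
  field_simp

/-- if `S` has the univariate Riesz (gamma) density with parameters
`ν/2 - k, ρ` and, independently, `Y ~ KR^{II}_{n×m}(τ, 0, Θ, Σ)`, then
`T = S^{-1/2} Y + μ` has the matrix multivariate T-Riesz type II density. -/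
theorem stmt_9 (n m : ℕ) (hm : 1 ≤ m) (hmn : m ≤ n)
    (Sig : Matrix (Fin m) (Fin m) ℝ) (hSig : Sig.PosDef)
    (Θ : Matrix (Fin n) (Fin n) ℝ) (hΘ : Θ.PosDef)
    (μ : Matrix (Fin n) (Fin m) ℝ) (ρ k ν : ℝ) (hρ : 0 < ρ) (hν : 0 < ν)
    (hνk : 0 < ν / 2 - k) (τ : Fin m → ℝ)
    (hτ : ∀ i : Fin m, 0 < (n : ℝ) / 2 - τ i - ((m : ℝ) - 1 - (i : ℝ)) / 2)
    (U : Matrix (Fin m) (Fin m) ℝ) (hU : U.BlockTriangular id)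
    (hUd : ∀ i, 0 < U i i) (hUSig : Sig = Uᵀ * U)
    {Ω : Type*} [MeasurableSpace Ω] (P : Measure Ω) [IsProbabilityMeasure P]
    (S : Ω → ℝ) (Y : Ω → Matrix (Fin n) (Fin m) ℝ)
    (hSY : ProbabilityTheory.IndepFun S Y P)
    (hS : Measure.map S P = volume.withDensity fun s =>
      if 0 < s then
        ENNReal.ofReal (s ^ (ν / 2 - k - 1) * Real.exp (-s / ρ) /
          (Real.Gamma (ν / 2 - k) * ρ ^ (ν / 2 - k)))
      else 0)
    (hY : Measure.map Y P =
      volume.withDensity fun y => ENNReal.ofReal (kotzRieszIIDen n m τ 0 Θ Sig U y)) :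
    Measure.map (fun ω => S ω ^ (-(1 : ℝ) / 2) • Y ω + μ) P =
      volume.withDensity fun t =>
        ENNReal.ofReal (tRieszIIDen n m ν k ρ τ μ Θ Sig U t) := by
  set g : ℝ → ENNReal := fun s =>
    if 0 < s then
      ENNReal.ofReal (s ^ (ν / 2 - k - 1) * Real.exp (-s / ρ) /
        (Real.Gamma (ν / 2 - k) * ρ ^ (ν / 2 - k)))
    else 0 with hgdef
  have hg : Measurable g := Measurable.ite measurableSet_Ioi (by fun_prop) measurable_const
  have hg0 : ∀ s ≤ 0, g s = 0 := fun s hs => if_neg (not_lt.2 hs)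
  have hmap := map_rpow_smul_add_prod_withDensity (E := Fin n → Fin m → ℝ) volume g hg hg0 _
    (measurable_kotzRieszIIDen n m τ Θ Sig U).ennreal_ofReal μ
  have hdens := funext fun t => lintegral_gamma_mul_kotzRieszIIDen hm Sig Θ hΘ μ hρ hνk τ hτ U
    hUSig t
  have hmain : Measure.map (fun p : ℝ × Matrix (Fin n) (Fin m) ℝ => p.1 ^ (-(1 : ℝ) / 2) • p.2 + μ)
      ((Measure.map S P).prod (Measure.map Y P)) =
      volume.withDensity fun t => ENNReal.ofReal (tRieszIIDen n m ν k ρ τ μ Θ Sig U t) := by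
    rw [hS, hY, ← hdens]
    exact hmap
  have hΦ : Measurable
      (fun p : ℝ × Matrix (Fin n) (Fin m) ℝ => p.1 ^ (-(1 : ℝ) / 2) • p.2 + μ) := by
    have : Measurable (fun p : ℝ × (Fin n → Fin m → ℝ) => p.1 ^ (-(1 : ℝ) / 2) • p.2 + (show Fin n → Fin m → ℝ from μ)) := by
      fun_prop
    exact this
  have hgpos : ∀ s, 0 < s → g s ≠ 0 := fun s hs => by
    have := Real.Gamma_pos_of_pos hνk
    simp only [hgdef, if_pos hs, ne_eq, ENNReal.ofReal_eq_zero, not_le]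
    positivity
  have hSm : AEMeasurable S P := by
    refine AEMeasurable.of_map_ne_zero fun h => ?_
    rw [hS, withDensity_eq_zero_iff hg.aemeasurable] at h
    have : volume (Set.Ioi (0 : ℝ)) = 0 :=
      measure_mono_null (fun s hs => hgpos s hs) (ae_iff.1 h)
    simp at this
  have hSpos : ∀ᵐ ω ∂P, 0 < S ω := by
    refine ae_of_ae_map hSm (p := fun s => 0 < s) ?_
    rw [hS, ae_withDensity_iff hg]
    exact Filter.Eventually.of_forall fun s hs => not_le.1 fun h => hs (hg0 s h)
  rw [← hmain]
  by_cases hYm : AEMeasurable Y P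
  · rw [← (ProbabilityTheory.indepFun_iff_map_prod_eq_prod_map_map hSm hYm).1 hSY,
      AEMeasurable.map_map_of_aemeasurable hΦ.aemeasurable (hSm.prodMk hYm)]
    rfl
  · rw [Measure.map_of_not_aemeasurable hYm, Measure.prod_zero, Measure.map_zero]
    refine Measure.map_of_not_aemeasurable fun hT => hYm ?_
    have hΨ : Measurable
        (fun p : ℝ × Matrix (Fin n) (Fin m) ℝ => p.1 ^ ((1 : ℝ) / 2) • (p.2 - μ)) := by
      have : Measurable (fun p : ℝ × (Fin n → Fin m → ℝ) => p.1 ^ ((1 : ℝ) / 2) • (p.2 - (show Fin n → Fin m → ℝ from μ))) := by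
        fun_prop
      exact this
    refine (hΨ.comp_aemeasurable (hSm.prodMk hT)).congr ?_
    filter_upwards [hSpos] with ω hω
    simp only [Function.comp_apply, add_sub_cancel_right, smul_smul]
    rw [← Real.rpow_add hω]
    norm_num
end

section
/- Let n ≥ m ≥ 1, let Σ be an m×m real positive definite matrix, and let τ = (t₁, …, t_m) ∈ ℝ^m with n/2 + t_i − (i−1)/2 > 0 for all i. If the random n×m real matrix Y has the Kotz-Riesz type I distribution KR^I_{n×m}(τ, 0, I_n, Σ), then W = YᵀY has, with respect to Lebesgue measure on m×m real symmetric matrices restricted to the positive definite cone, the Riesz type I density f(W) = exp(−tr(Σ^{−1}W)) · det(W)^{(n−m−1)/2} · q_τ(W) / (Γ_m(n/2, τ) · (det Σ)^{n/2} · q_τ(Σ)), for W positive definite. -/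
open MeasureTheory Matrix Real
open scoped Classical

/-- Radial integration in `ℝᵏ` with respect to the squared Euclidean norm. -/
theorem lintegral_dotProduct_self {k : ℕ} (hk : 0 < k) {f : ℝ → ENNReal} (hf : Measurable f) :
    ∫⁻ u : Fin k → ℝ, f (u ⬝ᵥ u) =
      ENNReal.ofReal (π ^ ((k : ℝ) / 2) / Gamma ((k : ℝ) / 2)) *
        ∫⁻ s in Set.Ioi (0 : ℝ), ENNReal.ofReal (s ^ ((k : ℝ) / 2 - 1)) * f s := by
  have hk' : (0 : ℝ) < (k : ℝ) / 2 := by positivity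
  have hG : 0 < Gamma ((k : ℝ) / 2) := Gamma_pos_of_pos hk'
  set c : ℝ := π ^ ((k : ℝ) / 2) / Gamma ((k : ℝ) / 2) with hc
  have hc0 : 0 ≤ c := by positivity
  have hmeas : Measurable fun u : Fin k → ℝ => u ⬝ᵥ u :=
    (Continuous.dotProduct continuous_id continuous_id).measurable
  have hdens : Measurable fun s : ℝ => ENNReal.ofReal (c * s ^ ((k : ℝ) / 2 - 1)) := by fun_prop
  have hball (r : ℝ) : (volume.map fun u : Fin k → ℝ => u ⬝ᵥ u) (Set.Iio r) =
      ENNReal.ofReal (√r ^ k) * ENNReal.ofReal (√π ^ k / Gamma ((k : ℝ) / 2 + 1)) := by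
    have : Nonempty (Fin k) := ⟨⟨0, hk⟩⟩
    rw [Measure.map_apply hmeas measurableSet_Iio]
    have h := EuclideanSpace.volume_ball (Fin k) 0 (√r)
    rw [← (PiLp.volume_preserving_toLp (Fin k)).measure_preimage
      measurableSet_ball.nullMeasurableSet, Fintype.card_fin,
      ← ENNReal.ofReal_pow (sqrt_nonneg r)] at h
    rw [← h]
    congr 1
    ext u
    simp only [Set.mem_preimage, Set.mem_Iio, mem_ball_zero_iff, EuclideanSpace.norm_eq,
      norm_eq_abs, sq_abs, dotProduct]
    rw [Real.sqrt_lt_sqrt_iff (by positivity)]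
    simp only [sq]
  have hmap : volume.map (fun u : Fin k → ℝ => u ⬝ᵥ u) =
      (volume.restrict (Set.Ioi (0 : ℝ))).withDensity
        fun s => ENNReal.ofReal (c * s ^ ((k : ℝ) / 2 - 1)) := by
    refine Measure.ext_of_generateFrom_of_iUnion (Set.range Set.Iio) (fun i : ℕ => Set.Iio (i : ℝ))
      (by rw [← borel_eq_generateFrom_Iio]; exact BorelSpace.measurable_eq) isPiSystem_Iio
      ?_ (fun i => ⟨_, rfl⟩) (fun i => ?_) ?_
    · ext x
      simpa using exists_nat_gt x
    · rw [hball]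
      finiteness
    · rintro _ ⟨r, rfl⟩
      rw [hball, withDensity_apply _ measurableSet_Iio, Measure.restrict_restrict measurableSet_Iio,
        Set.inter_comm, Set.Ioi_inter_Iio]
      rcases le_or_gt r 0 with hr | hr
      · rw [Real.sqrt_eq_zero_of_nonpos hr, zero_pow hk.ne', Set.Ioo_eq_empty (not_lt.2 hr)]
        simp
      · have hint : IntervalIntegrable (fun s : ℝ => c * s ^ ((k : ℝ) / 2 - 1)) volume 0 r :=
          (intervalIntegral.intervalIntegrable_rpow' (by linarith)).const_mul c
        rw [← ofReal_integral_eq_lintegral_ofReal, ← integral_Ioc_eq_integral_Ioo,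
          ← intervalIntegral.integral_of_le hr.le, intervalIntegral.integral_const_mul,
          integral_rpow (Or.inl (by linarith)), ← ENNReal.ofReal_mul (by positivity)]
        · congr 1
          rw [Gamma_add_one hk'.ne', sub_add_cancel, zero_rpow hk'.ne', hc, sqrt_eq_rpow r,
            sqrt_eq_rpow π, ← rpow_mul_natCast hr.le, ← rpow_mul_natCast pi_pos.le]
          rw [show (1 / 2 : ℝ) * k = k / 2 by ring]
          field_simp
          ring
        · exact ((intervalIntegrable_iff_integrableOn_Ioo_of_le hr.le).1 hint)
        · refine (ae_restrict_iff' measurableSet_Ioo).2 (Filter.Eventually.of_forall fun s hs => ?_)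
          exact mul_nonneg hc0 (rpow_nonneg hs.1.le _)
  rw [← lintegral_map hf hmeas, hmap, lintegral_withDensity_eq_lintegral_mul _ hdens hf,
    ← lintegral_const_mul _ (by fun_prop)]
  refine lintegral_congr fun s => ?_
  rw [Pi.mul_apply, ENNReal.ofReal_mul hc0, mul_assoc]

instance (n m : ℕ) : BorelSpace (Matrix (Fin n) (Fin m) ℝ) :=
  inferInstanceAs (BorelSpace (Fin n → Fin m → ℝ))

instance (n m : ℕ) : SecondCountableTopology (Matrix (Fin n) (Fin m) ℝ) :=
  inferInstanceAs (SecondCountableTopology (Fin n → Fin m → ℝ))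

instance (n m : ℕ) : SigmaFinite (volume : Measure (Matrix (Fin n) (Fin m) ℝ)) :=
  inferInstanceAs (SigmaFinite (volume : Measure (Fin n → Fin m → ℝ)))

theorem lintegral_pi_comp_equiv {ι ι' : Type*} [Fintype ι] [Fintype ι'] (e : ι ≃ ι')
    (f : (ι' → ℝ) → ENNReal) : ∫⁻ z : ι' → ℝ, f z = ∫⁻ w : ι → ℝ, f (w ∘ e.symm) := by
  have h := volume_preserving_arrowCongr' e (MeasurableEquiv.refl ℝ) (MeasurePreserving.id _)
  exact (h.lintegral_comp_emb (MeasurableEquiv.measurableEmbedding _) f).symm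

theorem lintegral_pi_sum {ι ι' : Type*} [Fintype ι] [Fintype ι'] {f : (ι ⊕ ι' → ℝ) → ENNReal}
    (hf : Measurable f) :
    ∫⁻ z : ι ⊕ ι' → ℝ, f z = ∫⁻ v : ι → ℝ, ∫⁻ u : ι' → ℝ, f (Sum.elim v u) := by
  have h := volume_measurePreserving_sumPiEquivProdPi_symm fun _ : ι ⊕ ι' => ℝ
  rw [← h.lintegral_comp_emb (MeasurableEquiv.measurableEmbedding _) f, Measure.volume_eq_prod]
  exact lintegral_prod _ (hf.comp h.measurable).aemeasurable

/-- The symmetric matrix `[[W, v], [vᵀ, w]]`. -/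
def bordered {m : ℕ} (W : Matrix (Fin m) (Fin m) ℝ) (v : Fin m → ℝ) (w : ℝ) :
    Matrix (Fin (m + 1)) (Fin (m + 1)) ℝ :=
  (fromBlocks W (replicateCol (Fin 1) v) (replicateRow (Fin 1) v) (of fun _ _ => w)).submatrix
    finSumFinEquiv.symm finSumFinEquiv.symm

theorem continuous_bordered {m : ℕ} : Continuous
    fun p : Matrix (Fin m) (Fin m) ℝ × (Fin m → ℝ) × ℝ => bordered p.1 p.2.1 p.2.2 := by
  refine Continuous.matrix_submatrix (Continuous.matrix_fromBlocks continuous_fst ?_ ?_ ?_) _ _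
  · exact continuous_matrix fun i _ => (continuous_apply i).comp (by fun_prop)
  · exact continuous_matrix fun _ i => (continuous_apply i).comp (by fun_prop)
  · exact continuous_matrix fun _ _ => by fun_prop

section entries

variable {m : ℕ} (W : Matrix (Fin m) (Fin m) ℝ) (v : Fin m → ℝ) (w : ℝ)

@[simp] theorem bordered_castSucc_castSucc (i j : Fin m) :
    bordered W v w i.castSucc j.castSucc = W i j := by
  change fromBlocks _ _ _ _ (finSumFinEquiv.symm (Fin.castAdd 1 i))
    (finSumFinEquiv.symm (Fin.castAdd 1 j)) = _
  simp only [finSumFinEquiv_symm_apply_castAdd, fromBlocks_apply₁₁]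

@[simp] theorem bordered_castSucc_last (i : Fin m) :
    bordered W v w i.castSucc (Fin.last m) = v i := by
  change fromBlocks _ _ _ _ (finSumFinEquiv.symm (Fin.castAdd 1 i))
    (finSumFinEquiv.symm (Fin.natAdd m (0 : Fin 1))) = _
  simp only [finSumFinEquiv_symm_apply_castAdd, finSumFinEquiv_symm_apply_natAdd,
    fromBlocks_apply₁₂, replicateCol_apply]

@[simp] theorem bordered_last_castSucc (i : Fin m) :
    bordered W v w (Fin.last m) i.castSucc = v i := by
  change fromBlocks _ _ _ _ (finSumFinEquiv.symm (Fin.natAdd m (0 : Fin 1)))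
    (finSumFinEquiv.symm (Fin.castAdd 1 i)) = _
  simp only [finSumFinEquiv_symm_apply_castAdd, finSumFinEquiv_symm_apply_natAdd,
    fromBlocks_apply₂₁, replicateRow_apply]

@[simp] theorem bordered_last_last : bordered W v w (Fin.last m) (Fin.last m) = w := by
  change fromBlocks _ _ _ _ (finSumFinEquiv.symm (Fin.natAdd m (0 : Fin 1)))
    (finSumFinEquiv.symm (Fin.natAdd m (0 : Fin 1))) = _
  simp only [finSumFinEquiv_symm_apply_natAdd, fromBlocks_apply₂₂, of_apply]

end entries

/-- The symmetric matrix with prescribed entries on and above the diagonal. -/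
def symmOfUpper (m : ℕ) (f : {p : Fin m × Fin m // p.1 ≤ p.2} → ℝ) : Matrix (Fin m) (Fin m) ℝ :=
  Matrix.of fun i j => if h : i ≤ j then f ⟨(i, j), h⟩ else f ⟨(j, i), le_of_not_ge h⟩

theorem measurable_symmOfUpper (m : ℕ) : Measurable (symmOfUpper m) := by
  refine (continuous_matrix fun i j => ?_).measurable
  unfold symmOfUpper
  by_cases h : i ≤ j <;> simp only [of_apply, h, dite_true, dite_false] <;> fun_prop

theorem symmVol_eq_map (m : ℕ) : symmVol m = volume.map (symmOfUpper m) := by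
  unfold symmVol symmOfUpper
  congr!

theorem lintegral_symmVol_zero (F : Matrix (Fin 0) (Fin 0) ℝ → ENNReal) :
    ∫⁻ A, F A ∂symmVol 0 = F 0 := by
  have : symmVol 0 = Measure.dirac 0 := by
    rw [symmVol_eq_map, volume_pi, Measure.pi_of_empty,
      Measure.map_dirac' (measurable_symmOfUpper 0)]
    congr
    exact Subsingleton.elim _ _
  rw [this]
  have hF : F = fun _ => F 0 := funext fun A => congrArg F (Subsingleton.elim _ _)
  rw [hF]
  simp

/-- The pairs `i ≤ j` in `Fin (m + 1)`, split according to whether they involve the last index. -/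
noncomputable def upperSuccEquiv (m : ℕ) :
    {p : Fin m × Fin m // p.1 ≤ p.2} ⊕ (Fin m ⊕ Fin 1) ≃
      {p : Fin (m + 1) × Fin (m + 1) // p.1 ≤ p.2} :=
  Equiv.ofBijective
    (Sum.elim (fun p => ⟨(p.1.1.castSucc, p.1.2.castSucc), Fin.castSucc_le_castSucc_iff.2 p.2⟩)
      (Sum.elim (fun i => ⟨(i.castSucc, Fin.last m), Fin.le_last _⟩)
        fun _ => ⟨(Fin.last m, Fin.last m), le_rfl⟩)) <| by
    constructor
    · rintro (⟨⟨i, j⟩, h⟩ | i | i) (⟨⟨i', j'⟩, h'⟩ | i' | i') <;>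
        simp [Fin.ext_iff] <;> omega
    · rintro ⟨⟨i, j⟩, h⟩
      induction j using Fin.lastCases with
      | last =>
        induction i using Fin.lastCases with
        | last => exact ⟨Sum.inr (Sum.inr 0), rfl⟩
        | cast i => exact ⟨Sum.inr (Sum.inl i), rfl⟩
      | cast j =>
        induction i using Fin.lastCases with
        | last => exact absurd h (not_le.2 (Fin.castSucc_lt_last j))
        | cast i => exact ⟨Sum.inl ⟨(i, j), Fin.castSucc_le_castSucc_iff.1 h⟩, rfl⟩

theorem symmOfUpper_comp_upperSuccEquiv {m : ℕ} (f : {p : Fin m × Fin m // p.1 ≤ p.2} → ℝ)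
    (v : Fin m → ℝ) (w : Fin 1 → ℝ) :
    symmOfUpper (m + 1) (Sum.elim f (Sum.elim v w) ∘ (upperSuccEquiv m).symm) =
      bordered (symmOfUpper m f) v (w 0) := by
  have h₁ (i j : Fin m) (h : i ≤ j) : (upperSuccEquiv m).symm ⟨(i.castSucc, j.castSucc),
      Fin.castSucc_le_castSucc_iff.2 h⟩ = Sum.inl ⟨(i, j), h⟩ :=
    (Equiv.symm_apply_eq _).2 rfl
  have h₂ (i : Fin m) : (upperSuccEquiv m).symm ⟨(i.castSucc, Fin.last m), Fin.le_last _⟩ =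
      Sum.inr (Sum.inl i) := (Equiv.symm_apply_eq _).2 rfl
  have h₃ : (upperSuccEquiv m).symm ⟨(Fin.last m, Fin.last m), le_rfl⟩ =
      Sum.inr (Sum.inr 0) := (Equiv.symm_apply_eq _).2 rfl
  ext i j
  induction i using Fin.lastCases with
  | last =>
    induction j using Fin.lastCases with
    | last => simp [symmOfUpper, h₃]
    | cast j => simp [symmOfUpper, h₂, not_le.2 (Fin.castSucc_lt_last j)]
  | cast i =>
    induction j using Fin.lastCases with
    | last => simp [symmOfUpper, h₂, Fin.le_last]
    | cast j =>
      by_cases h : i ≤ j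
      · simp [symmOfUpper, h, h₁]
      · simp [symmOfUpper, h, h₁, le_of_not_ge h]

theorem lintegral_symmVol_succ {m : ℕ} {F : Matrix (Fin (m + 1)) (Fin (m + 1)) ℝ → ENNReal}
    (hF : Measurable F) :
    ∫⁻ A, F A ∂symmVol (m + 1) =
      ∫⁻ W, (∫⁻ v : Fin m → ℝ, ∫⁻ w : ℝ, F (bordered W v w)) ∂symmVol m := by
  have hm : Measurable fun W : Matrix (Fin m) (Fin m) ℝ =>
      ∫⁻ v : Fin m → ℝ, ∫⁻ w : ℝ, F (bordered W v w) := by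
    refine Measurable.lintegral_prod_right' (f := fun p : Matrix (Fin m) (Fin m) ℝ × (Fin m → ℝ) =>
      ∫⁻ w : ℝ, F (bordered p.1 p.2 w)) ?_
    refine Measurable.lintegral_prod_right'
      (f := fun p : (Matrix (Fin m) (Fin m) ℝ × (Fin m → ℝ)) × ℝ => F (bordered p.1.1 p.1.2 p.2)) ?_
    exact hF.comp ((continuous_bordered (m := m)).measurable.comp
      (MeasurableEquiv.prodAssoc.measurable))
  have hE : Measurable fun z : {p : Fin m × Fin m // p.1 ≤ p.2} ⊕ (Fin m ⊕ Fin 1) → ℝ =>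
      z ∘ (upperSuccEquiv m).symm := by fun_prop
  have hF' := hF.comp ((measurable_symmOfUpper (m + 1)).comp hE)
  rw [symmVol_eq_map, symmVol_eq_map, lintegral_map hF (measurable_symmOfUpper _),
    lintegral_map hm (measurable_symmOfUpper _), lintegral_pi_comp_equiv (upperSuccEquiv m)]
  refine (lintegral_pi_sum hF').trans (lintegral_congr fun f => ?_)
  have hf : Measurable fun x : Fin m ⊕ Fin 1 → ℝ => Sum.elim f x :=
    (MeasurableEquiv.sumPiEquivProdPi fun _ => ℝ).symm.measurable.comp measurable_prodMk_left
  refine (lintegral_pi_sum (hF'.comp hf)).trans (lintegral_congr fun v => ?_)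
  rw [← (volume_preserving_funUnique (Fin 1) ℝ).lintegral_comp_emb
    (MeasurableEquiv.measurableEmbedding _)]
  refine lintegral_congr fun w => ?_
  simp only [Function.comp_apply, symmOfUpper_comp_upperSuccEquiv]
  rfl

/-- The matrix `[Y | y]`. -/
def appendCol {n m : ℕ} (Y : Matrix (Fin n) (Fin m) ℝ) (y : Fin n → ℝ) :
    Matrix (Fin n) (Fin (m + 1)) ℝ :=
  Matrix.of fun i => Fin.snoc (Y i) (y i)

theorem transpose_appendCol_mul_self {n m : ℕ} (Y : Matrix (Fin n) (Fin m) ℝ) (y : Fin n → ℝ) :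
    (appendCol Y y)ᵀ * appendCol Y y = bordered (Yᵀ * Y) (Yᵀ *ᵥ y) (y ⬝ᵥ y) := by
  ext i j
  induction i using Fin.lastCases <;> induction j using Fin.lastCases <;>
    simp [appendCol, mul_apply, mulVec, dotProduct, mul_comm]

theorem lintegral_matrix_succ {n m : ℕ} {F : Matrix (Fin n) (Fin (m + 1)) ℝ → ENNReal}
    (hF : Measurable F) :
    ∫⁻ Y, F Y = ∫⁻ Y : Matrix (Fin n) (Fin m) ℝ, ∫⁻ y : Fin n → ℝ, F (appendCol Y y) := by
  have h₁ := (volume_preserving_piFinSuccAbove (fun _ : Fin (m + 1) => ℝ) (Fin.last m)).symm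
  have h₂ := (volume_measurePreserving_arrowProdEquivProdArrow ℝ (Fin m → ℝ) (Fin n)).symm
  have h₃ := (volume_preserving_pi fun _ : Fin n => h₁).comp h₂
  have h₄ := h₃.lintegral_comp hF
  refine h₄.symm.trans ?_
  rw [Measure.volume_eq_prod]
  refine (lintegral_prod_symm _ (hF.comp h₃.measurable).aemeasurable).trans ?_
  refine lintegral_congr fun Y => lintegral_congr fun y => ?_
  refine congrArg F (Matrix.ext fun i j => ?_)
  simp [appendCol, MeasurableEquiv.piFinSuccAbove, Fin.insertNthEquiv,
    MeasurableEquiv.arrowProdEquivProdArrow, Equiv.arrowProdEquivProdArrow, Fin.insertNth_last']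

section schur

variable {m : ℕ} {W : Matrix (Fin m) (Fin m) ℝ}

theorem schurComplement_col (W : Matrix (Fin m) (Fin m) ℝ) (v : Fin m → ℝ) (w : ℝ) :
    (of fun _ _ => w : Matrix (Fin 1) (Fin 1) ℝ) -
        replicateRow (Fin 1) v * W⁻¹ * replicateCol (Fin 1) v =
      diagonal fun _ => w - v ⬝ᵥ W⁻¹ *ᵥ v := by
  ext i j
  rw [Subsingleton.elim i 0, Subsingleton.elim j 0, Matrix.sub_apply, Matrix.of_apply,
    diagonal_apply_eq, dotProduct_mulVec]
  rfl

theorem det_bordered (hW : W.det ≠ 0) (v : Fin m → ℝ) (w : ℝ) :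
    (bordered W v w).det = W.det * (w - v ⬝ᵥ W⁻¹ *ᵥ v) := by
  have := invertibleOfIsUnitDet W (isUnit_iff_ne_zero.2 hW)
  rw [bordered, det_submatrix_equiv_self, det_fromBlocks₁₁, invOf_eq_nonsing_inv,
    schurComplement_col]
  simp

theorem posDef_bordered_iff {v : Fin m → ℝ} {w : ℝ} :
    (bordered W v w).PosDef ↔ W.PosDef ∧ v ⬝ᵥ W⁻¹ *ᵥ v < w := by
  constructor
  · intro h
    have hW : W.PosDef := by
      have := h.submatrix (Fin.castSucc_injective m)
      convert this using 1
      ext i j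
      simp
    refine ⟨hW, ?_⟩
    have hd := h.det_pos
    rw [det_bordered hW.det_pos.ne'] at hd
    exact sub_pos.1 (pos_of_mul_pos_right hd hW.det_pos.le)
  · rintro ⟨hW, hq⟩
    have hq' := sub_pos.2 hq
    have hdet : (bordered W v w).det ≠ 0 := by
      rw [det_bordered hW.det_pos.ne']
      exact (mul_pos hW.det_pos hq').ne'
    refine (PosSemidef.posDef_iff_det_ne_zero ?_).2 hdet
    have := invertibleOfIsUnitDet W (isUnit_iff_ne_zero.2 hW.det_pos.ne')
    refine PosSemidef.submatrix ?_ _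
    have h := hW.fromBlocks₁₁ (replicateCol (Fin 1) v) (of fun _ _ => w)
    rw [show (replicateCol (Fin 1) v)ᴴ = replicateRow (Fin 1) v by
      ext; simp, schurComplement_col] at h
    exact h.2 (PosSemidef.diagonal fun _ => hq'.le)

end schur

theorem measurableSet_posDef (m : ℕ) :
    MeasurableSet {A : Matrix (Fin m) (Fin m) ℝ | A.PosDef} := by
  have h : {A : Matrix (Fin m) (Fin m) ℝ | A.PosDef} =
      {A | A.IsHermitian ∧ ∀ x : Fin m → ℝ, 0 ≤ star x ⬝ᵥ A *ᵥ x} ∩ {A | A.det ≠ 0} := by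
    ext A
    rw [Set.mem_inter_iff, Set.mem_ofPred_eq, Set.mem_ofPred_eq, Set.mem_ofPred_eq,
      ← posSemidef_iff_dotProduct_mulVec]
    exact ⟨fun h => ⟨h.posSemidef, h.det_pos.ne'⟩, fun h => h.1.posDef_iff_det_ne_zero.2 h.2⟩
  rw [h]
  refine MeasurableSet.inter (IsClosed.measurableSet ?_) (IsOpen.measurableSet ?_)
  · rw [Set.ofPred_and]
    refine IsClosed.inter (isClosed_eq (continuous_id.matrix_conjTranspose) continuous_id) ?_
    rw [Set.ofPred_forall]
    exact isClosed_iInter fun x => isClosed_le continuous_const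
      (continuous_const.dotProduct (continuous_id.matrix_mulVec continuous_const))
  · exact isOpen_ne_fun continuous_id.matrix_det continuous_const

/-- Every `n × p` matrix of full column rank extends to an invertible square matrix by adding
orthonormal columns orthogonal to its own. -/
theorem exists_orthonormal_complement {n p k : ℕ} (hn : n = p + k) (Y : Matrix (Fin n) (Fin p) ℝ)
    (hY : (Yᵀ * Y).det ≠ 0) :
    ∃ B : Matrix (Fin n) (Fin k) ℝ, Yᵀ * B = 0 ∧ Bᵀ * B = 1 := by
  set L : EuclideanSpace ℝ (Fin n) →ₗ[ℝ] EuclideanSpace ℝ (Fin p) := toEuclideanLin Yᵀ with hL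
  have hsurj : LinearMap.range L = ⊤ := by
    refine LinearMap.range_eq_top.2 fun z => ?_
    refine ⟨WithLp.toLp 2 (Y *ᵥ ((Yᵀ * Y)⁻¹ *ᵥ z.ofLp)), ?_⟩
    simp [hL, toLpLin_apply, mulVec_mulVec, ← Matrix.mul_assoc,
      mul_nonsing_inv _ (isUnit_iff_ne_zero.2 hY)]
  have hrank : Module.finrank ℝ (LinearMap.ker L) = k := by
    have := L.finrank_range_add_finrank_ker
    rw [hsurj, finrank_top, finrank_euclideanSpace_fin, finrank_euclideanSpace_fin] at this
    omega
  let b := (stdOrthonormalBasis ℝ (LinearMap.ker L)).reindex (finCongr hrank)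
  refine ⟨of fun i j => (b j : EuclideanSpace ℝ (Fin n)) i, ?_, ?_⟩
  · ext i j
    have hj : L (b j) = 0 := (b j).2
    exact congrArg (fun x => x.ofLp i) hj
  · ext i j
    have := orthonormal_iff_ite.1 b.orthonormal i j
    rw [Submodule.coe_inner, PiLp.inner_apply] at this
    rw [one_apply, ← this, mul_apply]
    exact Finset.sum_congr rfl fun x _ => mul_comm _ _

/-- Change of variables `y ↦ (Yᵀ y, Bᵀ y)`, where the columns of `B` form an orthonormal basis of
the orthogonal complement of the column space of `Y`. -/
theorem lintegral_transpose_mulVec {n p k : ℕ} (hn : n = p + k) {Y : Matrix (Fin n) (Fin p) ℝ}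
    (hY : (Yᵀ * Y).PosDef) {g : (Fin p → ℝ) → ℝ → ENNReal}
    (hg : Measurable (Function.uncurry g)) :
    ∫⁻ y : Fin n → ℝ, g (Yᵀ *ᵥ y) (y ⬝ᵥ y) = ENNReal.ofReal (√(Yᵀ * Y).det)⁻¹ *
      ∫⁻ v : Fin p → ℝ, ∫⁻ u : Fin k → ℝ, g v (v ⬝ᵥ (Yᵀ * Y)⁻¹ *ᵥ v + u ⬝ᵥ u) := by
  obtain ⟨B, hYB, hBB⟩ := exists_orthonormal_complement hn Y hY.det_pos.ne'
  have hBY : Bᵀ * Y = 0 := by rw [← transpose_eq_zero, transpose_mul, transpose_transpose, hYB]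
  have hWu : IsUnit (Yᵀ * Y).det := isUnit_iff_ne_zero.2 hY.det_pos.ne'
  let e : Fin p ⊕ Fin k ≃ Fin n := finSumFinEquiv.trans (finCongr hn.symm)
  let M : Matrix (Fin p ⊕ Fin k) (Fin n) ℝ := fromRows Yᵀ Bᵀ
  let N : Matrix (Fin n) (Fin n) ℝ := M.submatrix e.symm id
  have hMM : M * Mᵀ = fromBlocks (Yᵀ * Y) 0 0 1 := by
    rw [transpose_fromRows, fromRows_mul_fromCols, transpose_transpose, transpose_transpose, hYB,
      hBY, hBB]
  have hNN : N * Nᵀ = (fromBlocks (Yᵀ * Y) 0 0 1 : Matrix (Fin p ⊕ Fin k) _ ℝ).submatrix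
      e.symm e.symm := by
    rw [← hMM, transpose_submatrix]
    exact submatrix_mul_equiv M Mᵀ e.symm (Equiv.refl _) e.symm
  have hdet : N.det ^ 2 = (Yᵀ * Y).det := by
    have := congrArg det hNN
    rw [det_submatrix_equiv_self, det_mul, det_transpose, det_fromBlocks_zero₂₁, det_one,
      mul_one] at this
    rw [sq, this]
  have hN : N.det ≠ 0 := by
    intro h
    rw [h] at hdet
    exact hY.det_pos.ne (by simpa using hdet)
  have hNv (y : Fin n → ℝ) : (N *ᵥ y) ∘ e = Sum.elim (Yᵀ *ᵥ y) (Bᵀ *ᵥ y) := by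
    rw [← fromRows_mulVec]
    ext i
    simp [N, M, mulVec]
  have hquad (y : Fin n → ℝ) : y ⬝ᵥ y =
      (Yᵀ *ᵥ y) ⬝ᵥ (Yᵀ * Y)⁻¹ *ᵥ (Yᵀ *ᵥ y) + (Bᵀ *ᵥ y) ⬝ᵥ (Bᵀ *ᵥ y) := by
    obtain ⟨D, hD⟩ : ∃ D : Matrix (Fin p ⊕ Fin k) (Fin p ⊕ Fin k) ℝ,
        D = fromBlocks (Yᵀ * Y)⁻¹ 0 0 1 := ⟨_, rfl⟩
    have hMinv : (Mᵀ * D) * M = 1 := by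
      have h₁ : M * (Mᵀ * D) = 1 := by
        rw [← Matrix.mul_assoc, hMM, hD, fromBlocks_multiply]
        simp [mul_nonsing_inv _ hWu]
      exact (mul_eq_one_comm_of_equiv e).1 h₁
    calc y ⬝ᵥ y = y ⬝ᵥ ((Mᵀ * D) * M) *ᵥ y := by
          rw [hMinv, one_mulVec]
      _ = (M *ᵥ y) ⬝ᵥ D *ᵥ (M *ᵥ y) := by
          rw [← mulVec_mulVec, ← mulVec_mulVec, dotProduct_mulVec, vecMul_transpose]
      _ = _ := by
          rw [fromRows_mulVec, hD, fromBlocks_mulVec]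
          simp
  let h : (Fin p ⊕ Fin k → ℝ) → ENNReal := fun z =>
    g (z ∘ Sum.inl) (z ∘ Sum.inl ⬝ᵥ (Yᵀ * Y)⁻¹ *ᵥ (z ∘ Sum.inl) + z ∘ Sum.inr ⬝ᵥ z ∘ Sum.inr)
  have hh : Measurable h := by
    refine hg.comp (Continuous.measurable (f := fun z : Fin p ⊕ Fin k → ℝ => (z ∘ Sum.inl,
      z ∘ Sum.inl ⬝ᵥ (Yᵀ * Y)⁻¹ *ᵥ (z ∘ Sum.inl) + z ∘ Sum.inr ⬝ᵥ z ∘ Sum.inr)) ?_)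
    have hl : Continuous fun z : Fin p ⊕ Fin k → ℝ => z ∘ Sum.inl := by fun_prop
    have hr : Continuous fun z : Fin p ⊕ Fin k → ℝ => z ∘ Sum.inr := by fun_prop
    exact hl.prodMk ((hl.dotProduct (continuous_const.matrix_mulVec hl)).add (hr.dotProduct hr))
  have hhe : Measurable fun z : Fin n → ℝ => h (z ∘ e) := hh.comp (by fun_prop)
  have hL : Measurable (toLin' N) := (LinearMap.continuous_on_pi _).measurable
  calc ∫⁻ y : Fin n → ℝ, g (Yᵀ *ᵥ y) (y ⬝ᵥ y)
      = ∫⁻ y : Fin n → ℝ, h (toLin' N y ∘ e) := by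
        refine lintegral_congr fun y => ?_
        rw [toLin'_apply, hNv, hquad]
        rfl
    _ = ENNReal.ofReal |N.det⁻¹| * ∫⁻ z : Fin n → ℝ, h (z ∘ e) := by
        rw [← lintegral_map hhe hL, Real.map_matrix_volume_pi_eq_smul_volume_pi hN,
          lintegral_smul_measure, smul_eq_mul]
    _ = _ := by
        rw [← hdet, sqrt_sq_eq_abs, abs_inv, lintegral_pi_comp_equiv e]
        simp only [Function.comp_assoc, Equiv.symm_comp_self, Function.comp_id]
        rw [lintegral_pi_sum hh]
        rfl

theorem lintegral_const_add_dotProduct_self {k : ℕ} (hk : 0 < k) {f : ℝ → ENNReal} (hf : Measurable f)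
    (q : ℝ) :
    ∫⁻ u : Fin k → ℝ, f (q + u ⬝ᵥ u) =
      ENNReal.ofReal (π ^ ((k : ℝ) / 2) / Gamma ((k : ℝ) / 2)) *
        ∫⁻ w in Set.Ioi q, ENNReal.ofReal ((w - q) ^ ((k : ℝ) / 2 - 1)) * f w := by
  rw [lintegral_dotProduct_self hk (f := fun s => f (q + s)) (by fun_prop)]
  congr 1
  rw [← lintegral_indicator measurableSet_Ioi, ← lintegral_indicator measurableSet_Ioi,
    ← lintegral_sub_right_eq_self _ q]
  refine lintegral_congr fun w => ?_
  simp only [Set.indicator, Set.mem_Ioi, sub_pos, add_sub_cancel]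

theorem measurable_schurQuadratic (m : ℕ) :
    Measurable fun p : Matrix (Fin m) (Fin m) ℝ × (Fin m → ℝ) => p.2 ⬝ᵥ p.1⁻¹ *ᵥ p.2 := by
  simp only [inv_def, Ring.inverse_eq_inv', smul_mulVec, dotProduct_smul, smul_eq_mul]
  refine Measurable.mul (Measurable.inv ?_) ?_
  · exact continuous_fst.matrix_det.measurable
  · exact (continuous_snd.dotProduct
      (continuous_fst.matrix_adjugate.matrix_mulVec continuous_snd)).measurable

theorem mvGamma_pos {m : ℕ} {a : ℝ} (h : ∀ i : Fin m, 0 < a - (i : ℝ) / 2) : 0 < mvGamma m a :=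
  mul_pos (by positivity) (Finset.prod_pos fun i _ => Gamma_pos_of_pos (h i))

theorem mvGamma_succ (m : ℕ) (a : ℝ) :
    mvGamma (m + 1) a = mvGamma m a * (π ^ ((m : ℝ) / 2) * Gamma (a - (m : ℝ) / 2)) := by
  have h : (((m + 1) * (m + 1 - 1) : ℕ) : ℝ) / 4 = ((m * (m - 1) : ℕ) : ℝ) / 4 + (m : ℝ) / 2 := by
    rcases m with _ | m
    · simp
    · push_cast [Nat.add_sub_cancel]
      ring
  rw [mvGamma, mvGamma, h, rpow_add pi_pos, Fin.prod_univ_castSucc]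
  simp only [Fin.val_castSucc, Fin.val_last]
  ring

theorem continuous_transpose_mul_self (n m : ℕ) :
    Continuous fun Y : Matrix (Fin n) (Fin m) ℝ => Yᵀ * Y :=
  continuous_id.matrix_transpose.matrix_mul continuous_id

theorem ae_posDef_transpose_mul_self {n m : ℕ} {c : ENNReal}
    {d : Matrix (Fin m) (Fin m) ℝ → ENNReal}
    (h : ∀ F : Matrix (Fin m) (Fin m) ℝ → ENNReal, Measurable F →
      ∫⁻ Y : Matrix (Fin n) (Fin m) ℝ, F (Yᵀ * Y) =
        c * ∫⁻ W, (if W.PosDef then d W * F W else 0) ∂symmVol m) :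
    ∀ᵐ Y : Matrix (Fin n) (Fin m) ℝ, (Yᵀ * Y).PosDef := by
  have hS : Measurable ({A : Matrix (Fin m) (Fin m) ℝ | A.PosDef}ᶜ.indicator
      fun _ => (1 : ENNReal)) := measurable_const.indicator (measurableSet_posDef m).compl
  have hz (W : Matrix (Fin m) (Fin m) ℝ) : (if W.PosDef then
      d W * {A : Matrix (Fin m) (Fin m) ℝ | A.PosDef}ᶜ.indicator (fun _ => (1 : ENNReal)) W
      else 0) = 0 := by
    split_ifs with hW
    · simp [hW]
    · rfl
  have h₀ := h _ hS
  simp only [hz, lintegral_zero, mul_zero] at h₀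
  replace h₀ := (lintegral_eq_zero_iff
    (hS.comp (continuous_transpose_mul_self n m).measurable)).1 h₀
  filter_upwards [h₀] with Y hY
  by_contra hcon
  simp [hcon] at hY

/-- The pushforward of Lebesgue measure on `n × m` matrices under `Y ↦ YᵀY`. -/
theorem lintegral_transpose_mul_self {n m : ℕ} (hmn : m ≤ n)
    {F : Matrix (Fin m) (Fin m) ℝ → ENNReal} (hF : Measurable F) :
    ∫⁻ Y : Matrix (Fin n) (Fin m) ℝ, F (Yᵀ * Y) =
      ENNReal.ofReal (π ^ (((m * n : ℕ) : ℝ) / 2) / mvGamma m ((n : ℝ) / 2)) *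
        ∫⁻ W, (if W.PosDef then
          ENNReal.ofReal (W.det ^ (((n : ℝ) - (m : ℝ) - 1) / 2)) * F W else 0) ∂symmVol m := by
  induction m with
  | zero =>
    have h0 : (0 : Matrix (Fin 0) (Fin 0) ℝ).PosDef := by
      rw [Subsingleton.elim 0 (1 : Matrix (Fin 0) (Fin 0) ℝ)]
      exact PosDef.one
    have hc (Y : Matrix (Fin n) (Fin 0) ℝ) : F (Yᵀ * Y) = F 0 :=
      congrArg F (Subsingleton.elim _ _)
    have hvol : (volume : Measure (Matrix (Fin n) (Fin 0) ℝ)) Set.univ = 1 := by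
      change Measure.pi (fun _ : Fin n => (volume : Measure (Fin 0 → ℝ))) Set.univ = 1
      simp [Measure.pi_univ, volume_pi]
    rw [lintegral_symmVol_zero, if_pos h0]
    simp only [hc, lintegral_const, hvol]
    simp [mvGamma]
  | succ m ih =>
    have hmn' : m ≤ n := by omega
    obtain ⟨k, rfl⟩ := Nat.exists_eq_add_of_le hmn'
    have hk : 0 < k := by omega
    have hdetm (r : ℝ) : Measurable fun A : Matrix (Fin (m + 1)) (Fin (m + 1)) ℝ =>
        ENNReal.ofReal (A.det ^ r) :=
      ENNReal.measurable_ofReal.comp (continuous_id.matrix_det.measurable.pow_const r)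
    have hae : ∀ᵐ Y : Matrix (Fin (m + k)) (Fin m) ℝ, (Yᵀ * Y).PosDef := 
      ae_posDef_transpose_mul_self fun _ hF => ih hmn' hF
    let G : Matrix (Fin m) (Fin m) ℝ → ENNReal := fun W => ENNReal.ofReal (√W.det)⁻¹ *
      ∫⁻ v : Fin m → ℝ, ∫⁻ u : Fin k → ℝ, F (bordered W v (v ⬝ᵥ W⁻¹ *ᵥ v + u ⬝ᵥ u))
    have hG : Measurable G := by
      refine Measurable.mul (ENNReal.measurable_ofReal.comp
        (continuous_id.matrix_det.measurable.sqrt.inv)) ?_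
      refine Measurable.lintegral_prod_right'
        (f := fun p : Matrix (Fin m) (Fin m) ℝ × (Fin m → ℝ) =>
          ∫⁻ u : Fin k → ℝ, F (bordered p.1 p.2 (p.2 ⬝ᵥ p.1⁻¹ *ᵥ p.2 + u ⬝ᵥ u))) ?_
      refine Measurable.lintegral_prod_right'
        (f := fun p : (Matrix (Fin m) (Fin m) ℝ × (Fin m → ℝ)) × (Fin k → ℝ) =>
          F (bordered p.1.1 p.1.2 (p.1.2 ⬝ᵥ p.1.1⁻¹ *ᵥ p.1.2 + p.2 ⬝ᵥ p.2))) ?_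
      refine hF.comp ((continuous_bordered (m := m)).measurable.comp
        (measurable_fst.fst.prodMk (measurable_fst.snd.prodMk ?_)))
      exact ((measurable_schurQuadratic m).comp measurable_fst).add
        (continuous_snd.dotProduct continuous_snd).measurable
    have hstep : ∫⁻ Y : Matrix (Fin (m + k)) (Fin (m + 1)) ℝ, F (Yᵀ * Y) =
        ∫⁻ Y : Matrix (Fin (m + k)) (Fin m) ℝ, G (Yᵀ * Y) := by
      refine (lintegral_matrix_succ (hF.comp (continuous_transpose_mul_self _ _).measurable)).trans
        (lintegral_congr_ae (hae.mono fun Y hY => ?_))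
      simp only [Function.comp_apply, transpose_appendCol_mul_self]
      exact lintegral_transpose_mulVec rfl hY (g := fun v w => F (bordered (Yᵀ * Y) v w))
        (hF.comp ((continuous_bordered (m := m)).measurable.comp measurable_prodMk_left))
    have hH : Measurable fun A : Matrix (Fin (m + 1)) (Fin (m + 1)) ℝ => if A.PosDef then
        ENNReal.ofReal (A.det ^ ((((m + k : ℕ) : ℝ) - ((m + 1 : ℕ) : ℝ) - 1) / 2)) * F A
        else 0 :=
      Measurable.ite (measurableSet_posDef (m + 1)) ((hdetm _).mul hF) measurable_const
    have hmain (W : Matrix (Fin m) (Fin m) ℝ) :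
        (if W.PosDef then
          ENNReal.ofReal (W.det ^ ((((m + k : ℕ) : ℝ) - (m : ℝ) - 1) / 2)) * G W else 0) =
        ENNReal.ofReal (π ^ ((k : ℝ) / 2) / Gamma ((k : ℝ) / 2)) *
          ∫⁻ v : Fin m → ℝ, ∫⁻ w : ℝ, if (bordered W v w).PosDef then
            ENNReal.ofReal ((bordered W v w).det ^
              ((((m + k : ℕ) : ℝ) - ((m + 1 : ℕ) : ℝ) - 1) / 2)) * F (bordered W v w) else 0 := by
      by_cases hW : W.PosDef
      · have hd := hW.det_pos
        simp only [hW, if_true, G]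
        rw [← mul_assoc, ← ENNReal.ofReal_mul (by positivity),
          ← lintegral_const_mul' _ _ ENNReal.ofReal_ne_top,
          ← lintegral_const_mul' _ _ ENNReal.ofReal_ne_top]
        refine lintegral_congr fun v => ?_
        have hb : Measurable fun w => F (bordered W v w) :=
          hF.comp ((continuous_bordered (m := m)).measurable.comp
            (measurable_prodMk_left.comp measurable_prodMk_left))
        rw [lintegral_const_add_dotProduct_self hk hb, mul_left_comm]
        congr 1
        rw [← lintegral_const_mul' _ _ ENNReal.ofReal_ne_top,
          ← lintegral_indicator measurableSet_Ioi]
        refine lintegral_congr fun w => ?_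
        by_cases hw : v ⬝ᵥ W⁻¹ *ᵥ v < w
        · rw [Set.indicator_of_mem (Set.mem_Ioi.2 hw), if_pos (posDef_bordered_iff.2 ⟨hW, hw⟩),
            ← mul_assoc, ← ENNReal.ofReal_mul (by positivity), det_bordered hd.ne',
            mul_rpow hd.le (sub_pos.2 hw).le, sqrt_eq_rpow, ← rpow_neg hd.le, ← rpow_add hd]
          push_cast
          ring_nf
        · rw [Set.indicator_of_notMem (by simpa using hw),
            if_neg fun h => hw (posDef_bordered_iff.1 h).2]
      · have hz (v : Fin m → ℝ) (w : ℝ) : ¬ (bordered W v w).PosDef :=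
          fun h => hW (posDef_bordered_iff.1 h).1
        simp [hW, hz]
    rw [hstep, ih hmn' hG, lintegral_symmVol_succ hH]
    simp only [hmain]
    rw [lintegral_const_mul' _ _ ENNReal.ofReal_ne_top, ← mul_assoc]
    congr 1
    have hpos : 0 < mvGamma m (((m + k : ℕ) : ℝ) / 2) := mvGamma_pos fun i => by
      have : (i : ℝ) < m := by exact_mod_cast i.2
      push_cast
      have : (0 : ℝ) ≤ k := by positivity
      linarith
    rw [← ENNReal.ofReal_mul (by positivity), mvGamma_succ]
    congr 1
    have e₁ : (((m + k : ℕ) : ℝ)) / 2 - (m : ℝ) / 2 = (k : ℝ) / 2 := by push_cast; ring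
    have e₂ : ((((m + 1) * (m + k) : ℕ) : ℝ)) / 2 =
        (((m * (m + k) : ℕ) : ℝ)) / 2 + (k : ℝ) / 2 + (m : ℝ) / 2 := by push_cast; ring
    have hGk : 0 < Gamma ((k : ℝ) / 2) := Gamma_pos_of_pos (by positivity)
    rw [e₁, e₂, rpow_add pi_pos, rpow_add pi_pos]
    have : 0 < π ^ ((m : ℝ) / 2) := by positivity
    field_simp

section highestWeight

variable {m : ℕ}

theorem princMinor_pos {A : Matrix (Fin m) (Fin m) ℝ} (hA : A.PosDef) (i : Fin m) :
    0 < princMinor A i :=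
  (hA.submatrix (Fin.castLE_injective i.isLt)).det_pos

theorem hwv_pos (κ : Fin m → ℝ) {A : Matrix (Fin m) (Fin m) ℝ} (hA : A.PosDef) : 0 < hwv κ A :=
  Finset.prod_pos fun i _ => rpow_pos_of_pos (princMinor_pos hA i) _

theorem measurable_hwv (κ : Fin m → ℝ) : Measurable (hwv κ) := by
  refine Finset.measurable_fun_prod _ fun i _ => Measurable.pow_const ?_ _
  exact (continuous_id.matrix_submatrix _ _).matrix_det.measurable

theorem princMinor_transpose_mul_mul {U : Matrix (Fin m) (Fin m) ℝ} (hU : U.BlockTriangular id)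
    (A : Matrix (Fin m) (Fin m) ℝ) (i : Fin m) :
    princMinor (Uᵀ * A * U) i = princMinor U i ^ 2 * princMinor A i := by
  let c : Fin (i.1 + 1) → Fin m := Fin.castLE i.isLt
  have hc : Function.Injective c := Fin.castLE_injective i.isLt
  have hsum (f : Fin m → ℝ) (j : Fin (i.1 + 1)) :
      ∑ l, f l * U l (c j) = ∑ l, f (c l) * U (c l) (c j) := by
    rw [← Finset.sum_image (s := Finset.univ) (g := c) (f := fun l => f l * U l (c j)) hc.injOn]
    refine (Finset.sum_subset (Finset.subset_univ _) fun l _ hl => ?_).symm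
    have hlt : c j < l := by
      by_contra hcon
      have hle : l.1 ≤ j.1 := not_lt.1 hcon
      exact hl (Finset.mem_image.2 ⟨⟨l.1, by omega⟩, Finset.mem_univ _, rfl⟩)
    have h0 : U l (c j) = 0 := hU hlt
    rw [h0, mul_zero]
  have hsub : (Uᵀ * A * U).submatrix c c =
      (U.submatrix c c)ᵀ * A.submatrix c c * U.submatrix c c := by
    ext a b
    simp only [submatrix_apply, mul_apply, transpose_apply]
    rw [hsum]
    refine Finset.sum_congr rfl fun l _ => ?_
    congr 1
    simpa only [mul_comm] using hsum (fun x => A x (c l)) a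
  change ((Uᵀ * A * U).submatrix c c).det = (U.submatrix c c).det ^ 2 * (A.submatrix c c).det
  rw [hsub, det_mul, det_mul, det_transpose]
  ring

theorem hwv_transpose_mul_mul (κ : Fin m → ℝ) {U : Matrix (Fin m) (Fin m) ℝ}
    (hU : U.BlockTriangular id) {A : Matrix (Fin m) (Fin m) ℝ} (hA : A.PosDef) :
    hwv κ (Uᵀ * A * U) = hwv κ (Uᵀ * U) * hwv κ A := by
  have hone (i : Fin m) : princMinor (Uᵀ * U) i = princMinor U i ^ 2 := by
    have h₁ : princMinor (1 : Matrix (Fin m) (Fin m) ℝ) i = 1 := by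
      rw [princMinor, submatrix_one _ (Fin.castLE_injective i.isLt), det_one]
    have := princMinor_transpose_mul_mul hU 1 i
    rwa [Matrix.mul_one, h₁, mul_one] at this
  unfold hwv
  rw [← Finset.prod_mul_distrib]
  refine Finset.prod_congr rfl fun i _ => ?_
  rw [princMinor_transpose_mul_mul hU, hone,
    mul_rpow (sq_nonneg _) (princMinor_pos hA i).le]

end highestWeight

theorem mvGammaI_pos {m : ℕ} {a : ℝ} {τ : Fin m → ℝ} (h : ∀ i, 0 < a + τ i - (i : ℝ) / 2) :
    0 < mvGammaI m a τ :=
  mul_pos (by positivity) (Finset.prod_pos fun i _ => Gamma_pos_of_pos (h i))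

/-- if `Y ~ KR^I_{n×m}(τ, 0, I_n, Σ)`, then `W = YᵀY` has the Riesz type I
density with respect to Lebesgue measure on symmetric matrices restricted to the
positive definite cone. -/

theorem stmt_10 (n m : ℕ) (hm : 1 ≤ m) (hmn : m ≤ n)
    (Sig : Matrix (Fin m) (Fin m) ℝ) (hSig : Sig.PosDef)
    (τ : Fin m → ℝ) (hτ : ∀ i : Fin m, 0 < (n : ℝ) / 2 + τ i - (i : ℝ) / 2)
    (U : Matrix (Fin m) (Fin m) ℝ) (hU : U.BlockTriangular id)
    (hUd : ∀ i, 0 < U i i) (hUSig : Sig = Uᵀ * U)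
    {Ω : Type*} [MeasurableSpace Ω] (P : Measure Ω) [IsProbabilityMeasure P]
    (Y : Ω → Matrix (Fin n) (Fin m) ℝ)
    (hY : Measure.map Y P =
      volume.withDensity fun y => ENNReal.ofReal (kotzRieszIDen n m τ 0 1 Sig U y)) :
    Measure.map (fun ω => (Y ω)ᵀ * Y ω) P =
      (symmVol m).withDensity fun W =>
        if W.PosDef then
          ENNReal.ofReal (Real.exp (-(Sig⁻¹ * W).trace) *
            W.det ^ (((n : ℝ) - (m : ℝ) - 1) / 2) * hwv τ W /
            (mvGammaI m ((n : ℝ) / 2) τ * Sig.det ^ ((n : ℝ) / 2) * hwv τ Sig))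
        else 0 := by
  have hUdet : IsUnit U.det := by
    rw [det_of_isUpperTriangular hU]
    exact isUnit_iff_ne_zero.2 (Finset.prod_pos fun i _ => hUd i).ne'
  have hUtdet : IsUnit Uᵀ.det := by rwa [det_transpose]
  have hUinj : Function.Injective (U⁻¹).mulVec :=
    mulVec_injective_iff_isUnit.2 (isUnit_nonsing_inv_iff.2 ((isUnit_iff_isUnit_det U).2 hUdet))
  have hΓ : 0 < mvGamma m ((n : ℝ) / 2) := mvGamma_pos fun i => by
    have h₁ : (i : ℝ) < m := by exact_mod_cast i.2
    have h₂ : (m : ℝ) ≤ n := by exact_mod_cast hmn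
    linarith
  have hΓI : 0 < mvGammaI m ((n : ℝ) / 2) τ := mvGammaI_pos hτ
  have hSd : 0 < Sig.det := hSig.det_pos
  have hSw : 0 < hwv τ Sig := hwv_pos τ hSig
  have hX {W : Matrix (Fin m) (Fin m) ℝ} (hW : W.PosDef) : ((Uᵀ)⁻¹ * W * U⁻¹).PosDef := by
    have := hW.conjTranspose_mul_mul_same hUinj
    rwa [conjTranspose_eq_transpose_of_trivial, transpose_nonsing_inv] at this
  have hwvW {W : Matrix (Fin m) (Fin m) ℝ} (hW : W.PosDef) :
      hwv τ W = hwv τ Sig * hwv τ ((Uᵀ)⁻¹ * W * U⁻¹) := by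
    rw [hUSig, ← hwv_transpose_mul_mul τ hU (hX hW)]
    congr 1
    rw [Matrix.mul_assoc (Uᵀ)⁻¹, ← Matrix.mul_assoc Uᵀ, mul_nonsing_inv _ hUtdet, Matrix.one_mul,
      Matrix.mul_assoc, nonsing_inv_mul _ hUdet, Matrix.mul_one]
  let φ : Matrix (Fin m) (Fin m) ℝ → ℝ := fun W =>
    mvGamma m ((n : ℝ) / 2) /
        (π ^ (((m * n : ℕ) : ℝ) / 2) * mvGammaI m ((n : ℝ) / 2) τ * Sig.det ^ ((n : ℝ) / 2)) *
      exp (-(Sig⁻¹ * W).trace) * hwv τ ((Uᵀ)⁻¹ * W * U⁻¹)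
  have hφ : Measurable φ := by
    have h₁ : Continuous fun W : Matrix (Fin m) (Fin m) ℝ => exp (-(Sig⁻¹ * W).trace) :=
      continuous_exp.comp (continuous_const.matrix_mul continuous_id).matrix_trace.neg
    have h₂ : Continuous fun W : Matrix (Fin m) (Fin m) ℝ => (Uᵀ)⁻¹ * W * U⁻¹ :=
      (continuous_const.matrix_mul continuous_id).matrix_mul continuous_const
    exact (h₁.measurable.const_mul _).mul ((measurable_hwv τ).comp h₂.measurable)
  have hφpos {W : Matrix (Fin m) (Fin m) ℝ} (hW : W.PosDef) : 0 < φ W :=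
    mul_pos (by positivity) (hwv_pos τ (hX hW))
  have hkotz (y : Matrix (Fin n) (Fin m) ℝ) : kotzRieszIDen n m τ 0 1 Sig U y = φ (yᵀ * y) := by
    simp [kotzRieszIDen, φ, Matrix.mul_assoc]
  simp only [hkotz] at hY
  have hgram := (continuous_transpose_mul_self n m).measurable
  have hYm : AEMeasurable Y P := by
    by_contra hcon
    rw [Measure.map_of_not_aemeasurable hcon] at hY
    have h₀ := (withDensity_eq_zero_iff
      (hφ.ennreal_ofReal.comp hgram).aemeasurable).1 hY.symm
    have hpd := ae_posDef_transpose_mul_self fun _ hF =>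
      lintegral_transpose_mul_self (n := n) hmn hF
    have hfalse : ∀ᵐ _ : Matrix (Fin n) (Fin m) ℝ, False := by
      filter_upwards [h₀, hpd] with y hy hp
      exact (ENNReal.ofReal_pos.2 (hφpos hp)).ne' hy
    rw [Filter.eventually_false_iff_eq_bot, ae_eq_bot] at hfalse
    exact NeZero.ne (volume : Measure (Fin n → Fin m → ℝ)) hfalse
  have hmap : Measure.map (fun ω => (Y ω)ᵀ * Y ω) P =
      (volume.withDensity fun y : Matrix (Fin n) (Fin m) ℝ =>
        ENNReal.ofReal (φ (yᵀ * y))).map fun y => yᵀ * y := by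
    rw [← hY, AEMeasurable.map_map_of_aemeasurable hgram.aemeasurable hYm]
    rfl
  rw [hmap]
  ext S hS
  have hF : Measurable (S.indicator fun W => ENNReal.ofReal (φ W)) :=
    hφ.ennreal_ofReal.indicator hS
  rw [Measure.map_apply hgram hS, withDensity_apply _ (hgram hS), withDensity_apply _ hS,
    ← lintegral_indicator (hgram hS), ← lintegral_indicator hS]
  refine (lintegral_transpose_mul_self hmn hF).trans ?_
  rw [← lintegral_const_mul' _ _ ENNReal.ofReal_ne_top]
  refine lintegral_congr fun W => ?_
  by_cases hWS : W ∈ S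
  · by_cases hW : W.PosDef
    · have hWd := hW.det_pos
      simp only [Set.indicator_of_mem hWS, hW, if_true]
      rw [← ENNReal.ofReal_mul (by positivity), ← ENNReal.ofReal_mul (by positivity), hwvW hW]
      congr 1
      simp only [φ]
      have hπ : 0 < π ^ (((m * n : ℕ) : ℝ) / 2) := by positivity
      have hSr : 0 < Sig.det ^ ((n : ℝ) / 2) := by positivity
      field_simp
    · simp [hWS, hW]
  · simp [hWS]
end
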